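/- Let U be a 2^(N-1) × 2^(N-1) unitary matrix. If the controlled gate C(U) = I ⊕ U lies in the Clifford Hierarchy on N qubits (in CH_k for some finite k ≥ 1), then there exists an integer m > 0 such that U^(2^m) is an element of the (N-1)-qubit Pauli group P_{N-1}, and U lies in the Clifford Hierarchy on N-1 qubits (in CH_j for some finite j ≥ 1). -/

import Mathlib

open Matrix

noncomputable section

/-- `QMat n` : operators on `n` qubits, identified with `2^n × 2^n` complex matrices
(indexed by bit strings `Fin n → Fin 2`). -/
abbrev QMat (n : ℕ) := Matrix (Fin n → Fin 2) (Fin n → Fin 2) ℂ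

/-- The single-qubit Pauli `X` matrix. -/
def σX : Matrix (Fin 2) (Fin 2) ℂ := !![0, 1; 1, 0]

/-- The single-qubit Pauli `Y` matrix. -/
def σY : Matrix (Fin 2) (Fin 2) ℂ := !![0, -Complex.I; Complex.I, 0]

/-- The single-qubit Pauli `Z` matrix. -/
def σZ : Matrix (Fin 2) (Fin 2) ℂ := !![1, 0; 0, -1]

/-- The set `{I, X, Y, Z}` of single-qubit Pauli matrices. -/
def pauliSet : Set (Matrix (Fin 2) (Fin 2) ℂ) := {1, σX, σY, σZ}

/-- The tensor (Kronecker) product `σ 0 ⊗ ⋯ ⊗ σ (n-1)` of single-qubit matrices. -/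
def tensorStr {n : ℕ} (σ : Fin n → Matrix (Fin 2) (Fin 2) ℂ) : QMat n :=
  fun f g => ∏ i, σ i (f i) (g i)

/-- The `n`-qubit Pauli group `P_n`: all `c • (σ₁ ⊗ ⋯ ⊗ σₙ)` with
`σᵢ ∈ {I, X, Y, Z}` and `c ∈ {1, -1, i, -i}`. -/
def PauliGroup (n : ℕ) : Set (QMat n) :=
  {P | ∃ c ∈ ({1, -1, Complex.I, -Complex.I} : Set ℂ),
    ∃ σ : Fin n → Matrix (Fin 2) (Fin 2) ℂ, (∀ i, σ i ∈ pauliSet) ∧ P = c • tensorStr σ}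

/-- Kronecker product `M ⊗ A` of a single-qubit matrix `M` with an `n`-qubit matrix `A`
(the single qubit is the first/topmost factor). -/
def kron {n : ℕ} (M : Matrix (Fin 2) (Fin 2) ℂ) (A : QMat n) : QMat (n + 1) :=
  fun f g => M (f 0) (g 0) * A (fun i => f i.succ) (fun i => g i.succ)

/-- The block-diagonal direct sum `A ⊕ B = |0⟩⟨0| ⊗ A + |1⟩⟨1| ⊗ B`. -/
def dSum {n : ℕ} (A B : QMat n) : QMat (n + 1) :=
  kron !![1, 0; 0, 0] A + kron !![0, 0; 0, 1] B

/-- The Clifford Hierarchy on `n` qubits: `CH n 1 = P_n`, and for `k ≥ 2`,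
`CH n k` consists of the unitaries `U` with `U P U† ∈ CH n (k-1)` for all `P ∈ P_n`.
(The index `0` is unused and set to `∅`.) -/
def CH (n : ℕ) : ℕ → Set (QMat n)
  | 0 => ∅
  | 1 => PauliGroup n
  | (k + 2) => {U | U ∈ unitary (QMat n) ∧ ∀ P ∈ PauliGroup n, U * P * star U ∈ CH n (k + 1)}

/-- The set of allowed phases. -/
def phases : Set ℂ := {1, -1, Complex.I, -Complex.I}

lemma phases_mul {a b : ℂ} (ha : a ∈ phases) (hb : b ∈ phases) : a * b ∈ phases := by
  simp only [phases, Set.mem_insert_iff, Set.mem_singleton_iff] at *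
  rcases ha with rfl | rfl | rfl | rfl <;> rcases hb with rfl | rfl | rfl | rfl <;> simp

lemma phases_star {a : ℂ} (ha : a ∈ phases) : star a * a = 1 := by
  simp only [phases, Set.mem_insert_iff, Set.mem_singleton_iff] at *
  rcases ha with rfl | rfl | rfl | rfl <;> simp

lemma pauliSet_mul {a b : Matrix (Fin 2) (Fin 2) ℂ} (ha : a ∈ pauliSet) (hb : b ∈ pauliSet) :
    ∃ c ∈ phases, ∃ d ∈ pauliSet, a * b = c • d := by
  have h1 : (1 : ℂ) ∈ phases := by simp [phases]
  have hI : Complex.I ∈ phases := by simp [phases]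
  have hI' : -Complex.I ∈ phases := by simp [phases]
  have p1 : (1 : Matrix (Fin 2) (Fin 2) ℂ) ∈ pauliSet := by simp [pauliSet]
  have pX : σX ∈ pauliSet := by simp [pauliSet]
  have pY : σY ∈ pauliSet := by simp [pauliSet]
  have pZ : σZ ∈ pauliSet := by simp [pauliSet]
  have ha' := ha
  have hb' := hb
  simp only [pauliSet, Set.mem_insert_iff, Set.mem_singleton_iff] at ha hb
  rcases ha with rfl | rfl | rfl | rfl
  · exact ⟨1, h1, b, hb', by simp⟩
  all_goals rcases hb with rfl | rfl | rfl | rfl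
  · exact ⟨1, h1, _, ha', by simp⟩
  · exact ⟨1, h1, 1, p1, by ext i j; fin_cases i <;> fin_cases j <;> simp [σX]⟩
  · exact ⟨_, hI, _, pZ, by ext i j; fin_cases i <;> fin_cases j <;> simp [σX, σY, σZ]⟩
  · exact ⟨_, hI', _, pY, by ext i j; fin_cases i <;> fin_cases j <;> simp [σX, σY, σZ]⟩
  · exact ⟨1, h1, _, ha', by simp⟩
  · exact ⟨_, hI', _, pZ, by ext i j; fin_cases i <;> fin_cases j <;> simp [σX, σY, σZ]⟩
  · exact ⟨1, h1, 1, p1, by ext i j; fin_cases i <;> fin_cases j <;> simp [σY]⟩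
  · exact ⟨_, hI, _, pX, by ext i j; fin_cases i <;> fin_cases j <;> simp [σX, σY, σZ]⟩
  · exact ⟨1, h1, _, ha', by simp⟩
  · exact ⟨_, hI, _, pY, by ext i j; fin_cases i <;> fin_cases j <;> simp [σX, σY, σZ]⟩
  · exact ⟨_, hI', _, pX, by ext i j; fin_cases i <;> fin_cases j <;> simp [σX, σY, σZ]⟩
  · exact ⟨1, h1, 1, p1, by ext i j; fin_cases i <;> fin_cases j <;> simp [σZ]⟩

lemma pauliSet_star {a : Matrix (Fin 2) (Fin 2) ℂ} (ha : a ∈ pauliSet) :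
    star a * a = 1 := by
  simp only [pauliSet, Set.mem_insert_iff, Set.mem_singleton_iff] at ha
  rcases ha with rfl | rfl | rfl | rfl
  · simp
  all_goals
    ext i j
    fin_cases i <;> fin_cases j <;>
      simp [σX, σY, σZ, Matrix.mul_apply, Matrix.star_apply]

lemma tensorStr_mul {n : ℕ} (σ τ : Fin n → Matrix (Fin 2) (Fin 2) ℂ) :
    tensorStr σ * tensorStr τ = tensorStr (fun i => σ i * τ i) := by
  ext f g
  simp only [tensorStr, Matrix.mul_apply, Finset.prod_univ_sum, Fintype.piFinset_univ,
    Finset.prod_mul_distrib]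

lemma tensorStr_smul {n : ℕ} (c : Fin n → ℂ) (σ : Fin n → Matrix (Fin 2) (Fin 2) ℂ) :
    tensorStr (fun i => c i • σ i) = (∏ i, c i) • tensorStr σ := by
  ext f g
  simp [tensorStr, Finset.prod_mul_distrib]

lemma tensorStr_one {n : ℕ} :
    tensorStr (fun _ : Fin n => (1 : Matrix (Fin 2) (Fin 2) ℂ)) = 1 := by
  ext f g
  simp only [tensorStr, Matrix.one_apply]
  by_cases h : f = g
  · simp [h]
  · rw [if_neg h]
    obtain ⟨i, hi⟩ := Function.ne_iff.mp h
    exact Finset.prod_eq_zero (Finset.mem_univ i) (if_neg hi)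

lemma tensorStr_star {n : ℕ} (σ : Fin n → Matrix (Fin 2) (Fin 2) ℂ) :
    star (tensorStr σ) = tensorStr (fun i => star (σ i)) := by
  ext f g
  simp [tensorStr, Matrix.star_apply]

lemma pauli_mul {n : ℕ} {P Q : QMat n} (hP : P ∈ PauliGroup n) (hQ : Q ∈ PauliGroup n) :
    P * Q ∈ PauliGroup n := by
  obtain ⟨c, hc, σ, hσ, rfl⟩ := hP
  obtain ⟨d, hd, τ, hτ, rfl⟩ := hQ
  choose e he ρ hρ h using fun i => pauliSet_mul (hσ i) (hτ i)
  refine ⟨c * d * ∏ i, e i, phases_mul (phases_mul hc hd) ?_, ρ, hρ, ?_⟩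
  · exact Finset.prod_induction e (· ∈ phases) (fun _ _ => phases_mul) (by simp [phases])
      (fun i _ => he i)
  · have : (fun i => σ i * τ i) = fun i => e i • ρ i := funext h
    rw [smul_mul_smul_comm, tensorStr_mul, this, tensorStr_smul, smul_smul]

lemma pauli_unitary {n : ℕ} {P : QMat n} (hP : P ∈ PauliGroup n) : P ∈ unitary (QMat n) := by
  obtain ⟨c, hc, σ, hσ, rfl⟩ := hP
  have h : star (c • tensorStr σ) * (c • tensorStr σ) = 1 := by
    have : (fun i => star (σ i) * σ i) = fun _ => 1 := funext fun i => pauliSet_star (hσ i)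
    rw [star_smul, smul_mul_smul_comm, tensorStr_star, tensorStr_mul, this, tensorStr_one,
      phases_star hc, one_smul]
  exact Unitary.mem_iff.mpr ⟨h, mul_eq_one_comm.mp h⟩

lemma kron_mul {n : ℕ} (M N : Matrix (Fin 2) (Fin 2) ℂ) (A B : QMat n) :
    kron M A * kron N B = kron (M * N) (A * B) := by
  ext f g
  simp only [kron, Matrix.mul_apply]
  rw [← (Fin.consEquiv (fun _ : Fin (n + 1) => Fin 2)).sum_comp, Fintype.sum_prod_type,
    Finset.sum_mul_sum]
  refine Finset.sum_congr rfl fun a _ => Finset.sum_congr rfl fun x _ => ?_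
  simp [Fin.consEquiv]
  ring

lemma kron_star {n : ℕ} (M : Matrix (Fin 2) (Fin 2) ℂ) (A : QMat n) :
    star (kron M A) = kron (star M) (star A) := by
  ext f g
  simp [kron, Matrix.star_apply]

lemma tensorStr_eq_kron {n : ℕ} (σ : Fin (n + 1) → Matrix (Fin 2) (Fin 2) ℂ) :
    tensorStr σ = kron (σ 0) (tensorStr fun i => σ i.succ) := by
  ext f g
  simp [tensorStr, kron, Fin.prod_univ_succ]

lemma kron_pauli {n : ℕ} {M : Matrix (Fin 2) (Fin 2) ℂ} (hM : M ∈ pauliSet) {P : QMat n}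
    (hP : P ∈ PauliGroup n) : kron M P ∈ PauliGroup (n + 1) := by
  obtain ⟨c, hc, σ, hσ, rfl⟩ := hP
  refine ⟨c, hc, Fin.cons M σ, fun i => ?_, ?_⟩
  · refine Fin.cases ?_ (fun i => ?_) i
    · simpa using hM
    · simpa using hσ i
  · rw [tensorStr_eq_kron]
    ext f g
    simp [kron]
    ring

lemma one_pauli {n : ℕ} : (1 : QMat n) ∈ PauliGroup n :=
  ⟨1, by simp, fun _ => 1, fun _ => by simp [pauliSet], by rw [tensorStr_one, one_smul]⟩

lemma dSum_cons {n : ℕ} (A B : QMat n) (a b : Fin 2) (f g : Fin n → Fin 2) :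
    dSum A B (Fin.cons a f) (Fin.cons b g) =
      (!![1, 0; 0, 0] : Matrix (Fin 2) (Fin 2) ℂ) a b * A f g +
        (!![0, 0; 0, 1] : Matrix (Fin 2) (Fin 2) ℂ) a b * B f g := by
  simp [dSum, kron]

lemma kron_cons {n : ℕ} (M : Matrix (Fin 2) (Fin 2) ℂ) (A : QMat n) (a b : Fin 2)
    (f g : Fin n → Fin 2) :
    kron M A (Fin.cons a f) (Fin.cons b g) = M a b * A f g := by
  simp [kron]

lemma kron_zero_left {n : ℕ} (A : QMat n) : kron 0 A = 0 := by
  ext f g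
  simp [kron]

lemma dSum_mul {n : ℕ} (A B C D : QMat n) :
    dSum A B * dSum C D = dSum (A * C) (B * D) := by
  have h1 : (!![1, 0; 0, 0] : Matrix (Fin 2) (Fin 2) ℂ) * (!![1, 0; 0, 0] : Matrix (Fin 2) (Fin 2) ℂ) = (!![1, 0; 0, 0] : Matrix (Fin 2) (Fin 2) ℂ) := by
    ext i j; fin_cases i <;> fin_cases j <;> simp [Matrix.mul_apply]
  have h2 : (!![0, 0; 0, 1] : Matrix (Fin 2) (Fin 2) ℂ) * (!![0, 0; 0, 1] : Matrix (Fin 2) (Fin 2) ℂ) = (!![0, 0; 0, 1] : Matrix (Fin 2) (Fin 2) ℂ) := by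
    ext i j; fin_cases i <;> fin_cases j <;> simp [Matrix.mul_apply]
  have h3 : (!![1, 0; 0, 0] : Matrix (Fin 2) (Fin 2) ℂ) * (!![0, 0; 0, 1] : Matrix (Fin 2) (Fin 2) ℂ) = 0 := by
    ext i j; fin_cases i <;> fin_cases j <;> simp [Matrix.mul_apply]
  have h4 : (!![0, 0; 0, 1] : Matrix (Fin 2) (Fin 2) ℂ) * (!![1, 0; 0, 0] : Matrix (Fin 2) (Fin 2) ℂ) = 0 := by
    ext i j; fin_cases i <;> fin_cases j <;> simp [Matrix.mul_apply]
  simp only [dSum, add_mul, mul_add, kron_mul, h1, h2, h3, h4, kron_zero_left, add_zero, zero_add]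

lemma dSum_star {n : ℕ} (A B : QMat n) : star (dSum A B) = dSum (star A) (star B) := by
  have h1 : star (!![1, 0; 0, 0] : Matrix (Fin 2) (Fin 2) ℂ) = !![1, 0; 0, 0] := by
    ext i j; fin_cases i <;> fin_cases j <;> simp [Matrix.star_apply]
  have h2 : star (!![0, 0; 0, 1] : Matrix (Fin 2) (Fin 2) ℂ) = !![0, 0; 0, 1] := by
    ext i j; fin_cases i <;> fin_cases j <;> simp [Matrix.star_apply]
  rw [dSum, star_add, kron_star, kron_star, h1, h2, dSum]

lemma dSum_self {n : ℕ} (A : QMat n) : dSum A A = kron 1 A := by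
  ext f g
  simp only [dSum, kron, Matrix.add_apply, ← add_mul]
  congr 1
  generalize f 0 = a
  generalize g 0 = b
  fin_cases a <;> fin_cases b <;> simp

/-- The Pauli `X` on the first qubit. -/
def X1 (n : ℕ) : QMat (n + 1) := kron σX 1

lemma X1_pauli {n : ℕ} : X1 n ∈ PauliGroup (n + 1) :=
  kron_pauli (by simp [pauliSet]) one_pauli

lemma X1_mul_self {n : ℕ} : X1 n * X1 n = 1 := by
  have h : σX * σX = 1 := by ext i j; fin_cases i <;> fin_cases j <;> simp [σX]
  rw [X1, kron_mul, h, one_mul, ← tensorStr_one, ← tensorStr_one, tensorStr_eq_kron]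

lemma X1_star {n : ℕ} : star (X1 n) = X1 n := by
  have h : star σX = σX := by
    ext i j; fin_cases i <;> fin_cases j <;> simp [σX, Matrix.star_apply]
  rw [X1, kron_star, h, star_one]

lemma X1_dSum {n : ℕ} (A B : QMat n) : X1 n * dSum A B = dSum B A * X1 n := by
  have h1 : σX * (!![1, 0; 0, 0] : Matrix (Fin 2) (Fin 2) ℂ) = (!![0, 0; 0, 1] : Matrix (Fin 2) (Fin 2) ℂ) * σX := by
    ext i j; fin_cases i <;> fin_cases j <;> simp [Matrix.mul_apply, σX]
  have h2 : σX * (!![0, 0; 0, 1] : Matrix (Fin 2) (Fin 2) ℂ) = (!![1, 0; 0, 0] : Matrix (Fin 2) (Fin 2) ℂ) * σX := by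
    ext i j; fin_cases i <;> fin_cases j <;> simp [Matrix.mul_apply, σX]
  simp only [X1, dSum, mul_add, add_mul, kron_mul, one_mul, mul_one, h1, h2]
  exact add_comm _ _

lemma CH_unitary {n k : ℕ} {V : QMat n} (h : V ∈ CH n k) : V ∈ unitary (QMat n) := by
  match k, h with
  | 1, h => exact pauli_unitary h
  | _ + 2, h => exact h.1

lemma CH_mul_X1 {n k : ℕ} {V : QMat (n + 1)} (h : V ∈ CH (n + 1) k) :
    V * X1 n ∈ CH (n + 1) k := by
  match k, h with
  | 1, h => exact pauli_mul h X1_pauli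
  | _ + 2, h =>
    refine ⟨mul_mem h.1 (pauli_unitary X1_pauli), fun P hP => ?_⟩
    have := h.2 _ (pauli_mul (pauli_mul X1_pauli hP) X1_pauli)
    rw [star_mul, X1_star]
    simpa only [mul_assoc] using this

lemma pauli_blocks {n : ℕ} {A B : QMat n} (hA : A ∈ unitary (QMat n))
    (h : dSum A B ∈ PauliGroup (n + 1)) : A ∈ PauliGroup n ∧ B ∈ PauliGroup n := by
  obtain ⟨c, hc, σ, hσ, h⟩ := h
  rw [tensorStr_eq_kron] at h
  have key : ∀ a b f g, _ := fun a b f g => congrFun (congrFun h (Fin.cons a f)) (Fin.cons b g)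
  simp only [dSum_cons, Matrix.smul_apply, kron_cons] at key
  have k0 := key 0 0
  have k1 := key 1 1
  simp at k0 k1
  have hne : ¬ ∀ f g, A f g = 0 := by
    intro h0
    have : A = 0 := by ext f g; exact h0 f g
    have h2 := (Unitary.mem_iff.mp hA).1
    rw [this, mul_zero] at h2
    exact zero_ne_one h2
  have hs := hσ 0
  have ht : ∀ i : Fin n, σ i.succ ∈ pauliSet := fun i => hσ _
  simp only [pauliSet, Set.mem_insert_iff, Set.mem_singleton_iff] at hs
  rcases hs with hs | hs | hs | hs <;> rw [hs] at k0 k1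
  · refine ⟨⟨c, hc, _, ht, ?_⟩, ⟨c, hc, _, ht, ?_⟩⟩
    · ext f g; simpa using k0 f g
    · ext f g; simpa using k1 f g
  · exact absurd (fun f g => by simpa [σX] using k0 f g) hne
  · exact absurd (fun f g => by simpa [σY] using k0 f g) hne
  · refine ⟨⟨c, hc, _, ht, ?_⟩, ⟨-1 * c, phases_mul (by simp [phases]) hc, _, ht, ?_⟩⟩
    · ext f g; simpa [σZ] using k0 f g
    · ext f g; simpa [σZ] using k1 f g

lemma CH_blocks {n : ℕ} (k : ℕ) : ∀ {A B : QMat n}, A ∈ unitary (QMat n) →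
    B ∈ unitary (QMat n) → dSum A B ∈ CH (n + 1) (k + 1) → B ∈ CH n (k + 1) := by
  induction k with
  | zero => exact fun hA _ h => (pauli_blocks hA h).2
  | succ k ih =>
    intro A B hA hB h
    refine ⟨hB, fun P hP => ?_⟩
    have h1 := h.2 (dSum P P) (by
      rw [dSum_self]; exact kron_pauli (by simp [pauliSet]) hP)
    rw [dSum_star, dSum_mul, dSum_mul] at h1
    have hPu := pauli_unitary hP
    exact ih (mul_mem (mul_mem hA hPu) (Unitary.star_mem hA))
      (mul_mem (mul_mem hB hPu) (Unitary.star_mem hB)) h1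

lemma power_pauli {n : ℕ} (k : ℕ) : ∀ {V : QMat n}, V ∈ unitary (QMat n) →
    dSum (star V) V ∈ CH (n + 1) (k + 1) → ∃ m : ℕ, V ^ 2 ^ m ∈ PauliGroup n := by
  induction k with
  | zero => exact fun hV h => ⟨0, by simpa using (pauli_blocks (Unitary.star_mem hV) h).2⟩
  | succ k ih =>
    intro V hV h
    have h1 := CH_mul_X1 (h.2 _ X1_pauli)
    rw [dSum_star, star_star, mul_assoc (dSum _ _) (X1 n), X1_dSum, ← mul_assoc, dSum_mul,
      mul_assoc, X1_mul_self, mul_one, ← star_mul] at h1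
    obtain ⟨m, hm⟩ := ih (mul_mem hV hV) h1
    refine ⟨m + 1, ?_⟩
    rwa [← pow_two, ← pow_mul, ← pow_succ'] at hm

/-- If the controlled gate `C(U) = I ⊕ U` lies in the Clifford Hierarchy
on `N = n + 1` qubits, then `U^(2^m)` is Pauli for some integer `m > 0`, and `U` lies in
the Clifford Hierarchy on `n` qubits. -/
theorem stmt6 (n : ℕ) (U : QMat n) (hU : U ∈ unitary (QMat n))
    (h : ∃ k, 1 ≤ k ∧ dSum 1 U ∈ CH (n + 1) k) :
    (∃ m : ℕ, 0 < m ∧ U ^ 2 ^ m ∈ PauliGroup n) ∧ (∃ j, 1 ≤ j ∧ U ∈ CH n j) := by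
  obtain ⟨k, hk, h⟩ := h
  obtain ⟨k, rfl⟩ : ∃ l, k = l + 1 := ⟨k - 1, by omega⟩
  have hC := CH_blocks k (one_mem _) hU h
  refine ⟨?_, k + 1, hk, hC⟩
  have key : ∃ m : ℕ, U ^ 2 ^ m ∈ PauliGroup n := by
    cases k with
    | zero => exact ⟨0, by rw [pow_zero, pow_one]; exact hC⟩
    | succ k =>
      have h1 := CH_mul_X1 (h.2 _ X1_pauli)
      rw [dSum_star, star_one, mul_assoc (dSum _ _) (X1 n), X1_dSum, ← mul_assoc, dSum_mul,
        mul_assoc, X1_mul_self, mul_one, one_mul, mul_one] at h1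
      exact power_pauli k hU h1
  obtain ⟨m, hm⟩ := key
  refine ⟨m + 1, Nat.succ_pos m, ?_⟩
  rw [pow_succ, pow_mul, pow_two]
  exact pauli_mul hm hm
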